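/- arXiv:2510.24944 — 2 statements merged into one kernel-verified Lean document; each statement's English description precedes it below -/
import Mathlib

section
/- Let H be a real inner product space, let d : ℝ → H be continuous, and let G : ℝ → ℝ be a function with G(t) ≥ 0 for all t ≥ 0. Let μ ≥ 0, η ≥ 0, κ ∈ (0, 1] with μ + ηκ > 0, L ≥ 0, C > 0, h > 0, α > 0, and λ satisfy L²C²h²/(2α(μ + ηκ)) < λ < (μ + ηκ)/(C²h²). Suppose the function t ↦ ‖d(t)‖² is differentiable on [0, ∞) and its derivative satisfies, for all t ≥ 0, (d/dt)‖d(t)‖² ≤ 2·(−(μ + ηκ)G(t)² + L·C·h·G(t)·‖d(t)‖ − λα‖d(t)‖² + (λC²h²/2)·G(t)²). Then for all t ≥ 0, ‖d(t)‖ ≤ e^{−γ_η t}·‖d(0)‖, where γ_η = λα − L²C²h²/(2(μ + ηκ)) > 0. (This is the abstract form of the artificial-dissipation extension of IDDA in Remark 2.7: adding the term −ηΔd̃ to the IDDA dynamics, under the H¹-stability and alignment condition on the interpolation operator with efficiency constant κ, augments the effective diffusion from μ to μ + ηκ in the energy estimate.) -/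
/-- If the derivative of `‖d‖²` is at most `-2γ‖d‖²` on `[0, ∞)`, then `‖d‖` decays exponentially at rate
`γ`. -/
theorem norm_le_exp_mul_of_hasDerivAt_sq_le {E : Type*} [SeminormedAddCommGroup E]
    {d : ℝ → E} {D : ℝ → ℝ} {γ : ℝ}
    (hderiv : ∀ t ≥ (0 : ℝ), HasDerivAt (fun s => ‖d s‖ ^ 2) (D t) t)
    (hle : ∀ t ≥ (0 : ℝ), D t ≤ -(2 * γ) * ‖d t‖ ^ 2) {t : ℝ} (ht : 0 ≤ t) :
    ‖d t‖ ≤ Real.exp (-γ * t) * ‖d 0‖ := by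
  have hderiv_exp : ∀ s ≥ (0 : ℝ), HasDerivAt (fun s => Real.exp (2 * γ * s) * ‖d s‖ ^ 2)
      (Real.exp (2 * γ * s) * (2 * γ) * ‖d s‖ ^ 2 + Real.exp (2 * γ * s) * D s) s := by
    intro s hs
    exact (by simpa using ((hasDerivAt_id s).const_mul (2 * γ)).exp :
      HasDerivAt (fun s => Real.exp (2 * γ * s)) (Real.exp (2 * γ * s) * (2 * γ)) s).mul
      (hderiv s hs)
  have hanti : AntitoneOn (fun s => Real.exp (2 * γ * s) * ‖d s‖ ^ 2) (Set.Ici 0) := by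
    refine antitoneOn_of_deriv_nonpos (convex_Ici 0)
      (fun s hs => (hderiv_exp s hs).continuousAt.continuousWithinAt)
      (fun s hs => (hderiv_exp s (interior_subset hs)).differentiableAt.differentiableWithinAt)
      fun s hs => ?_
    have hs0 : (0 : ℝ) ≤ s := interior_subset hs
    rw [(hderiv_exp s hs0).deriv]
    linarith [mul_le_mul_of_nonneg_left (hle s hs0) (Real.exp_pos (2 * γ * s)).le]
  have hdecay : Real.exp (2 * γ * t) * ‖d t‖ ^ 2 ≤ ‖d 0‖ ^ 2 := by
    simpa using hanti (Set.mem_Ici.2 le_rfl) (Set.mem_Ici.2 ht) ht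
  have hscaled : Real.exp (γ * t) * ‖d t‖ ≤ ‖d 0‖ := by
    refine le_of_sq_le_sq ?_ (norm_nonneg _)
    rwa [mul_pow, ← Real.exp_nat_mul, Nat.cast_ofNat, ← mul_assoc]
  rwa [neg_mul, Real.exp_neg, ← div_eq_inv_mul, le_div_iff₀' (Real.exp_pos _)]

/-- Young's inequality absorbs the cross term `b * g * x` into half of the dissipation `m * g²`. -/
theorem dissipation_add_cross_le {m b c q g x : ℝ} (hm : 0 < m) (hq : q ≤ m) :
    -m * g ^ 2 + b * g * x - c * x ^ 2 + q / 2 * g ^ 2 ≤ -(c - b ^ 2 / (2 * m)) * x ^ 2 := by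
  have hsq : 0 ≤ (m * g - b * x) ^ 2 / (2 * m) := by positivity
  have hexpand : (m * g - b * x) ^ 2 / (2 * m)
      = m / 2 * g ^ 2 - b * g * x + b ^ 2 / (2 * m) * x ^ 2 := by
    field_simp
    ring
  nlinarith [mul_le_mul_of_nonneg_right hq (sq_nonneg g)]

/-- Abstract IDDA exponential convergence with artificial dissipation
(Remark 2.7): with effective diffusion `μ + ηκ`, under
`L²C²h²/(2α(μ+ηκ)) < λ < (μ+ηκ)/(C²h²)` and the corresponding energy
inequality, the error decays as `‖d t‖ ≤ e^{-γ_η t} ‖d 0‖` with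
`γ_η = λα - L²C²h²/(2(μ+ηκ)) > 0`. -/
theorem stmt_9 {H : Type*} [NormedAddCommGroup H] [InnerProductSpace ℝ H]
    (d : ℝ → H) (hd : Continuous d) (G : ℝ → ℝ) (hG : ∀ t ≥ (0 : ℝ), 0 ≤ G t)
    (μ η κ L C h α lam : ℝ)
    (hμ : 0 ≤ μ) (hη : 0 ≤ η) (hκ0 : 0 < κ) (hκ1 : κ ≤ 1) (heff : 0 < μ + η * κ)
    (hL : 0 ≤ L) (hC : 0 < C) (hh : 0 < h) (hα : 0 < α)
    (hlow : L ^ 2 * C ^ 2 * h ^ 2 / (2 * α * (μ + η * κ)) < lam)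
    (hhigh : lam < (μ + η * κ) / (C ^ 2 * h ^ 2))
    (D : ℝ → ℝ)
    (hderiv : ∀ t ≥ (0 : ℝ), HasDerivAt (fun s => ‖d s‖ ^ 2) (D t) t)
    (hineq : ∀ t ≥ (0 : ℝ),
      D t ≤ 2 * (-(μ + η * κ) * G t ^ 2 + L * C * h * G t * ‖d t‖
        - lam * α * ‖d t‖ ^ 2 + (lam * C ^ 2 * h ^ 2 / 2) * G t ^ 2)) :
    lam * α - L ^ 2 * C ^ 2 * h ^ 2 / (2 * (μ + η * κ)) > 0 ∧
      ∀ t ≥ (0 : ℝ),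
        ‖d t‖ ≤ Real.exp (-(lam * α - L ^ 2 * C ^ 2 * h ^ 2 / (2 * (μ + η * κ))) * t)
          * ‖d 0‖ := by
  constructor
  · rw [div_lt_iff₀ (by positivity)] at hlow
    rw [gt_iff_lt, sub_pos, div_lt_iff₀ (by positivity)]
    linarith
  · intro t ht
    rw [lt_div_iff₀ (by positivity)] at hhigh
    refine norm_le_exp_mul_of_hasDerivAt_sq_le hderiv (fun s hs => (hineq s hs).trans ?_) ht
    have h_absorb := dissipation_add_cross_le (b := L * C * h) (c := lam * α)
      (q := lam * C ^ 2 * h ^ 2) (g := G s) (x := ‖d s‖) heff (by linarith)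
    rw [mul_pow, mul_pow] at h_absorb
    linarith
end

section
/- Let H be a real inner product space, let d : ℝ → H be continuous, and let G : ℝ → ℝ be a function with G(t) ≥ 0 for all t ≥ 0. Let μ > 0, L ≥ 0, C > 0, h > 0, α* > 0, and λ satisfy λα* > L²C²h²/(2μ). Suppose the function t ↦ ‖d(t)‖² is differentiable on [0, ∞) and its derivative satisfies, for all t ≥ 0, (d/dt)‖d(t)‖² ≤ 2·(−μG(t)² + L·C·h·G(t)·‖d(t)‖ − λα*‖d(t)‖²). Then for all t ≥ 0, ‖d(t)‖ ≤ e^{−γt}·‖d(0)‖, where γ = λα* − L²C²h²/(2μ) > 0. (This is the abstract form of the IDDA energy estimate under the stronger observability condition ⟨f̃, f⟩ ≥ α*‖f‖² discussed in Section 2.3: in this regime the nudging term contributes no gradient penalty, so exponential decay holds for all sufficiently large λ with no upper bound on the nudging parameter.) -/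
/-- Grönwall's inequality in decay form: `f' ≤ c f` on `[0, ∞)` gives `f t ≤ e^{c t} f 0`. -/
theorem le_exp_mul_of_hasDerivAt_le_mul {f f' : ℝ → ℝ} {c : ℝ}
    (hf : ∀ t ≥ (0 : ℝ), HasDerivAt f (f' t) t) (hle : ∀ t ≥ (0 : ℝ), f' t ≤ c * f t)
    {t : ℝ} (ht : 0 ≤ t) : f t ≤ Real.exp (c * t) * f 0 := by
  have hg : ∀ s ≥ (0 : ℝ), HasDerivAt (fun s => Real.exp (-c * s) * f s)
      (Real.exp (-c * s) * (-c * 1) * f s + Real.exp (-c * s) * f' s) s := fun s hs =>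
    (((hasDerivAt_id s).const_mul (-c)).exp).mul (hf s hs)
  have hanti : AntitoneOn (fun s => Real.exp (-c * s) * f s) (Set.Ici 0) := by
    refine antitoneOn_of_deriv_nonpos (convex_Ici 0)
      (fun s hs => (hg s hs).continuousAt.continuousWithinAt) ?_ ?_
    · intro s hs
      exact (hg s (interior_subset hs)).differentiableAt.differentiableWithinAt
    · intro s hs
      have hs' : (0 : ℝ) ≤ s := interior_subset hs
      rw [(hg s hs').deriv]
      have := mul_le_mul_of_nonneg_left (hle s hs') (Real.exp_pos (-c * s)).le
      linarith
  have h0 : Real.exp (-c * t) * f t ≤ f 0 := by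
    simpa using hanti (Set.mem_Ici.2 le_rfl) (Set.mem_Ici.2 ht) ht
  calc f t = Real.exp (c * t) * (Real.exp (-c * t) * f t) := by
        rw [← mul_assoc, ← Real.exp_add]; simp
    _ ≤ Real.exp (c * t) * f 0 := mul_le_mul_of_nonneg_left h0 (Real.exp_pos _).le

/-- Young's inequality absorbing a cross term into a quadratic penalty. -/
theorem neg_mul_sq_add_mul_mul_le {μ : ℝ} (hμ : 0 < μ) (K g x : ℝ) :
    -μ * g ^ 2 + K * g * x ≤ K ^ 2 / (2 * μ) * x ^ 2 := by
  rw [div_mul_eq_mul_div, le_div_iff₀ (by positivity)]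
  nlinarith [sq_nonneg (μ * g - K * x), sq_nonneg (μ * g)]

/-- Abstract IDDA energy estimate under the stronger observability condition
(Section 2.3): if `λα* > L²C²h²/(2μ)` and the energy inequality without a
gradient penalty from nudging holds, then `‖d t‖ ≤ e^{-γ t} ‖d 0‖` with
`γ = λα* - L²C²h²/(2μ) > 0`. -/
theorem stmt_10 {H : Type*} [NormedAddCommGroup H] [InnerProductSpace ℝ H]
    (d : ℝ → H) (hd : Continuous d) (G : ℝ → ℝ) (hG : ∀ t ≥ (0 : ℝ), 0 ≤ G t)
    (μ L C h αstar lam : ℝ)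
    (hμ : 0 < μ) (hL : 0 ≤ L) (hC : 0 < C) (hh : 0 < h) (hαstar : 0 < αstar)
    (hlow : L ^ 2 * C ^ 2 * h ^ 2 / (2 * μ) < lam * αstar)
    (D : ℝ → ℝ)
    (hderiv : ∀ t ≥ (0 : ℝ), HasDerivAt (fun s => ‖d s‖ ^ 2) (D t) t)
    (hineq : ∀ t ≥ (0 : ℝ),
      D t ≤ 2 * (-μ * G t ^ 2 + L * C * h * G t * ‖d t‖
        - lam * αstar * ‖d t‖ ^ 2)) :
    lam * αstar - L ^ 2 * C ^ 2 * h ^ 2 / (2 * μ) > 0 ∧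
      ∀ t ≥ (0 : ℝ),
        ‖d t‖ ≤ Real.exp (-(lam * αstar - L ^ 2 * C ^ 2 * h ^ 2 / (2 * μ)) * t)
          * ‖d 0‖ := by
  refine ⟨sub_pos.2 hlow, fun t ht => ?_⟩
  set γ := lam * αstar - L ^ 2 * C ^ 2 * h ^ 2 / (2 * μ) with hγ
  have key : ∀ s ≥ (0 : ℝ), D s ≤ -2 * γ * ‖d s‖ ^ 2 := by
    intro s hs
    have hyoung := neg_mul_sq_add_mul_mul_le hμ (L * C * h) (G s) ‖d s‖
    rw [mul_pow, mul_pow] at hyoung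
    have := hineq s hs
    rw [hγ]
    linarith
  have hsq := le_exp_mul_of_hasDerivAt_le_mul hderiv key ht
  refine (pow_le_pow_iff_left₀ (norm_nonneg _) (by positivity) two_ne_zero).1 ?_
  have hexp : Real.exp (-γ * t) ^ 2 = Real.exp (-2 * γ * t) := by
    rw [← Real.exp_nat_mul]
    congr 1
    push_cast
    ring
  rw [mul_pow, hexp]
  exact hsq
end
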